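/- arXiv:1701.04351 — 3 statements merged into one kernel-verified Lean document; each statement's English description precedes it below -/
import Mathlib

section
/- Let σ : ℕ → [0,∞) satisfy ∑_{n∈ℕ} σ_n² < ∞ and let γ_σ = ⨂_{n∈ℕ} N(0,σ_n²) be the countable product probability measure on ℝ^ℕ. Then the function x ↦ ∑_{n∈ℕ} x_n² is finite γ_σ-almost everywhere, and ∫_{ℝ^ℕ} exp(−∑_{n∈ℕ} x_n²) dγ_σ(x) = ∏_{n∈ℕ} (1 + 2σ_n²)^{−1/2}, where the infinite product converges. -/
open MeasureTheory ProbabilityTheory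
open scoped NNReal

theorem integral_exp_neg_sq_gaussianReal (v : ℝ≥0) :
    ∫ x, Real.exp (-x ^ 2) ∂gaussianReal 0 v = ((1 : ℝ) + 2 * v) ^ (-(1 : ℝ) / 2) := by
  rcases eq_or_ne v 0 with rfl | hv
  · simp
  have hv' : (0 : ℝ) < v := by positivity
  have h (x : ℝ) : gaussianPDFReal 0 v x • Real.exp (-x ^ 2) =
      (√(2 * Real.pi * v))⁻¹ * Real.exp (-((2 * v : ℝ)⁻¹ + 1) * x ^ 2) := by
    rw [gaussianPDFReal, smul_eq_mul, mul_assoc, ← Real.exp_add]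
    congr 2
    field_simp
    ring
  rw [integral_gaussianReal_eq_integral_smul hv]
  simp_rw [h]
  rw [integral_const_mul, integral_gaussian, ← Real.sqrt_inv, ← Real.sqrt_mul (by positivity),
    neg_div, Real.rpow_neg (by positivity), ← Real.sqrt_eq_rpow, ← Real.sqrt_inv]
  congr 1
  field_simp

theorem lintegral_sq_gaussianReal (v : ℝ≥0) :
    ∫⁻ x, ENNReal.ofReal (x ^ 2) ∂gaussianReal 0 v = v := by
  have hL : MemLp (fun x : ℝ => x) 2 (gaussianReal 0 v) := memLp_id_gaussianReal 2
  rw [← ofReal_integral_eq_lintegral_ofReal hL.integrable_sq (ae_of_all _ fun x => sq_nonneg x),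
    ← variance_of_integral_eq_zero hL.aemeasurable integral_id_gaussianReal,
    variance_fun_id_gaussianReal, ENNReal.ofReal_coe_nnreal]

theorem summable_sq_ae_infinitePi_gaussianReal {v : ℕ → ℝ≥0} (hv : Summable v) :
    ∀ᵐ x ∂Measure.infinitePi (fun n => gaussianReal 0 (v n)), Summable fun n => (x n) ^ 2 := by
  have hm (n : ℕ) : Measurable fun x : ℕ → ℝ => ENNReal.ofReal (x n ^ 2) := by fun_prop
  have key : ∫⁻ x, ∑' n, ENNReal.ofReal (x n ^ 2)
      ∂Measure.infinitePi (fun n => gaussianReal 0 (v n)) ≠ ⊤ := by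
    rw [lintegral_tsum fun n => (hm n).aemeasurable]
    have h (n : ℕ) : ∫⁻ x, ENNReal.ofReal (x n ^ 2)
        ∂Measure.infinitePi (fun n => gaussianReal 0 (v n)) = v n := by
      rw [← lintegral_sq_gaussianReal]
      exact (measurePreserving_eval_infinitePi (fun n => gaussianReal 0 (v n)) n).lintegral_comp
        (f := fun y => ENNReal.ofReal (y ^ 2)) (by fun_prop)
    simp_rw [h]
    exact ENNReal.tsum_coe_ne_top_iff_summable.2 hv
  filter_upwards [ae_lt_top (Measurable.tsum hm) key] with x hx
  have := ENNReal.summable_toReal hx.ne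
  simpa [ENNReal.toReal_ofReal, sq_nonneg] using this

theorem integral_exp_neg_sum_sq_infinitePi_gaussianReal (v : ℕ → ℝ≥0) (s : Finset ℕ) :
    ∫ x, Real.exp (-∑ n ∈ s, (x n) ^ 2) ∂Measure.infinitePi (fun n => gaussianReal 0 (v n)) =
      ∏ n ∈ s, ((1 : ℝ) + 2 * v n) ^ (-(1 : ℝ) / 2) := by
  have h (x : ℕ → ℝ) : Real.exp (-∑ n ∈ s, (x n) ^ 2) =
      (fun y : s → ℝ => ∏ j, Real.exp (-(y j) ^ 2)) (s.restrict x) := by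
    simp only [Finset.restrict]
    rw [← Finset.sum_neg_distrib, Real.exp_sum, ← Finset.prod_coe_sort]
  rw [integral_congr_ae (ae_of_all _ h), integral_restrict_infinitePi
      (fun n => gaussianReal 0 (v n)) (f := fun y : s → ℝ => ∏ j, Real.exp (-(y j) ^ 2))
      (Measurable.aestronglyMeasurable (by fun_prop)),
    integral_fintype_prod_eq_prod (f := fun _ y => Real.exp (-y ^ 2))]
  simp_rw [integral_exp_neg_sq_gaussianReal]
  exact Finset.prod_coe_sort s fun n => ((1 : ℝ) + 2 * v n) ^ (-(1 : ℝ) / 2)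

theorem multipliable_one_add_two_mul_rpow {a : ℕ → ℝ} (ha : ∀ n, 0 ≤ a n) (hs : Summable a)
    (r : ℝ) : Multipliable fun n => (1 + 2 * a n) ^ r := by
  have hpos (n : ℕ) : 0 < 1 + 2 * a n := by have := ha n; positivity
  refine Real.multipliable_of_summable_log (fun n => Real.rpow_pos_of_pos (hpos n) _) ?_
  simp_rw [Real.log_rpow (hpos _)]
  exact (Real.summable_log_one_add_of_summable (hs.mul_left 2)).mul_left r

/-- For `σ : ℕ → [0,∞)` with `∑_n σ_n² < ∞` and `γ_σ = ⨂_{n∈ℕ} N(0,σ_n²)` the countable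
product probability measure on `ℝ^ℕ` (characterized as the projective limit of the finite
product Gaussian measures): the function `x ↦ ∑_n x_n²` is finite `γ_σ`-a.e., the infinite
product `∏_n (1 + 2σ_n²)^{-1/2}` converges, and
`∫ exp(-∑_n x_n²) dγ_σ(x) = ∏_n (1 + 2σ_n²)^{-1/2}`. -/
theorem stmt_9 (σ : ℕ → ℝ≥0) (hσ : Summable fun n => ((σ n : ℝ)) ^ 2)
    (γ : Measure (ℕ → ℝ))
    (hγ : IsProjectiveLimit γ fun J : Finset ℕ =>
      Measure.pi fun j : J => gaussianReal 0 ((σ j) ^ 2)) :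
    (∀ᵐ x ∂γ, Summable fun n => (x n) ^ 2) ∧
      Multipliable (fun n => ((1 : ℝ) + 2 * (σ n : ℝ) ^ 2) ^ (-(1 : ℝ) / 2)) ∧
      ∫ x, Real.exp (-∑' n, (x n) ^ 2) ∂γ =
        ∏' n, ((1 : ℝ) + 2 * (σ n : ℝ) ^ 2) ^ (-(1 : ℝ) / 2) := by
  obtain rfl : γ = Measure.infinitePi fun n => gaussianReal 0 (σ n ^ 2) :=
    hγ.unique (Measure.isProjectiveLimit_infinitePi fun n => gaussianReal 0 (σ n ^ 2))
  have hae := summable_sq_ae_infinitePi_gaussianReal (v := fun n => σ n ^ 2)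
    (by exact_mod_cast hσ)
  have hmul := multipliable_one_add_two_mul_rpow (fun n => sq_nonneg (σ n : ℝ)) hσ (-(1 : ℝ) / 2)
  refine ⟨hae, hmul, tendsto_nhds_unique ?_ hmul.hasProd.tendsto_prod_nat⟩
  have hfin (N : ℕ) := integral_exp_neg_sum_sq_infinitePi_gaussianReal (fun n => σ n ^ 2)
    (Finset.range N)
  push_cast at hfin
  simp_rw [← hfin]
  refine tendsto_integral_of_dominated_convergence (fun _ => 1)
    (fun N => Measurable.aestronglyMeasurable (by fun_prop)) (integrable_const _)
    (fun N => ae_of_all _ fun x => ?_) ?_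
  · rw [Real.norm_eq_abs, Real.abs_exp, Real.exp_le_one_iff, neg_nonpos]
    exact Finset.sum_nonneg fun n _ => sq_nonneg _
  · filter_upwards [hae] with x hx
    exact (Real.continuous_exp.tendsto _).comp hx.hasSum.tendsto_sum_nat.neg
end

section
/- Let a : ℕ → [0,∞) satisfy ∑_{n∈ℕ} a_n < ∞, let I ⊆ ℕ, and set b_n = a_n if n ∈ I and b_n = 0 otherwise. Then ∏_{n∈ℕ} (1 + 2b_n)^{−1/2} − ∏_{n∈ℕ} (1 + 2a_n)^{−1/2} ≥ ( ∑_{n∈ℕ∖I} a_n ) · exp(−6 ∑_{n∈ℕ} a_n ). -/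
/-- An infinite product of factors `(1 + 2 x n) ^ (-1/2)` as the exponential of a series. -/
lemma tprod_one_add_two_mul_rpow_neg_half {x : ℕ → ℝ} (hx : ∀ n, 0 ≤ x n)
    (hs : Summable fun n ↦ Real.log (1 + 2 * x n) / 2) :
    ∏' n, (1 + 2 * x n) ^ (-(1 : ℝ) / 2) = Real.exp (-∑' n, Real.log (1 + 2 * x n) / 2) := by
  have h := hs.hasSum.neg.rexp.tprod_eq
  rw [← h]
  refine tprod_congr fun n ↦ ?_
  rw [Real.rpow_def_of_pos (by linarith [hx n])]
  simp only [Function.comp]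
  congr 1
  ring

lemma half_log_one_add_two_mul_le {x : ℝ} (hx : 0 ≤ x) : Real.log (1 + 2 * x) / 2 ≤ x := by
  linarith [Real.log_le_sub_one_of_pos (show 0 < 1 + 2 * x by linarith)]

lemma half_log_one_add_two_mul_nonneg {x : ℝ} (hx : 0 ≤ x) :
    0 ≤ Real.log (1 + 2 * x) / 2 :=
  div_nonneg (Real.log_nonneg (by linarith)) zero_le_two

lemma mul_exp_neg_two_mul_le_half_log {x s : ℝ} (hx : 0 ≤ x) (hxs : x ≤ s) :
    x * Real.exp (-2 * s) ≤ Real.log (1 + 2 * x) / 2 := by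
  have hpos : 0 < 1 + 2 * x := by linarith
  have hlog := Real.one_sub_inv_le_log_of_pos hpos
  have hexp : Real.exp (-2 * s) ≤ (1 + 2 * x)⁻¹ := by
    rw [neg_mul, Real.exp_neg]
    exact inv_anti₀ hpos (by linarith [Real.add_one_le_exp (2 * s)])
  have hinv : 1 - (1 + 2 * x)⁻¹ = 2 * (x * (1 + 2 * x)⁻¹) := by
    field_simp
    ring
  linarith [mul_le_mul_of_nonneg_left hexp hx]

lemma sub_mul_exp_neg_le (u v : ℝ) :
    (v - u) * Real.exp (-v) ≤ Real.exp (-u) - Real.exp (-v) := by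
  have h : Real.exp (-u) = Real.exp (v - u) * Real.exp (-v) := by
    rw [← Real.exp_add]
    congr 1
    ring
  rw [h]
  nlinarith [Real.add_one_le_exp (v - u), Real.exp_pos (-v)]

/-- Lemma 9.5-type inequality: for `a : ℕ → [0,∞)` with `∑_n a_n < ∞`, `I ⊆ ℕ`, and
`b = 𝟙_I · a`, it holds that
`∏_n (1 + 2b_n)^{-1/2} - ∏_n (1 + 2a_n)^{-1/2} ≥ (∑_{n∉I} a_n) exp(-6 ∑_n a_n)`. -/
theorem stmt_10 (a : ℕ → ℝ) (ha : ∀ n, 0 ≤ a n) (hsum : Summable a) (I : Set ℕ)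
    (b : ℕ → ℝ) (hb : b = I.indicator a) :
    (∏' n, (1 + 2 * b n) ^ (-(1 : ℝ) / 2)) - ∏' n, (1 + 2 * a n) ^ (-(1 : ℝ) / 2) ≥
      (∑' n : {n : ℕ // n ∉ I}, a n) * Real.exp (-6 * ∑' n, a n) := by
  set g : ℕ → ℝ := fun n ↦ Real.log (1 + 2 * a n) / 2 with hg
  have hgs : Summable g := hsum.of_nonneg_of_le
    (fun n ↦ half_log_one_add_two_mul_nonneg (ha n)) fun n ↦ half_log_one_add_two_mul_le (ha n)
  have hbg : (fun n ↦ Real.log (1 + 2 * b n) / 2) = I.indicator g := by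
    funext n
    by_cases hn : n ∈ I <;> simp [hb, hg, hn]
  have hb0 : ∀ n, 0 ≤ b n := fun n ↦ hb ▸ Set.indicator_nonneg (fun n _ ↦ ha n) n
  rw [tprod_one_add_two_mul_rpow_neg_half ha hgs,
    tprod_one_add_two_mul_rpow_neg_half hb0 (hbg ▸ hgs.indicator I), hbg, ← tsum_subtype I g]
  have hsplit : ∑' n : I, g n + ∑' n : {n : ℕ // n ∉ I}, g n = ∑' n, g n :=
    (hgs.subtype I).tsum_add_tsum_compl (hgs.subtype Iᶜ)
  set S := ∑' n, a n
  have hT : (∑' n : {n : ℕ // n ∉ I}, a n) * Real.exp (-2 * S) ≤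
      ∑' n : {n : ℕ // n ∉ I}, g n := by
    rw [← tsum_mul_right]
    exact ((hsum.subtype Iᶜ).mul_right _).tsum_le_tsum
      (fun n ↦ mul_exp_neg_two_mul_le_half_log (ha n) (hsum.le_tsum _ fun m _ ↦ ha m))
      (hgs.subtype Iᶜ)
  have hgS : ∑' n, g n ≤ S :=
    hgs.tsum_le_tsum (fun n ↦ half_log_one_add_two_mul_le (ha n)) hsum
  have hT0 : 0 ≤ ∑' n : {n : ℕ // n ∉ I}, a n := tsum_nonneg fun n ↦ ha n
  have hS0 : 0 ≤ S := tsum_nonneg ha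
  calc (∑' n : {n : ℕ // n ∉ I}, a n) * Real.exp (-6 * S)
      ≤ (∑' n : {n : ℕ // n ∉ I}, a n) * (Real.exp (-2 * S) * Real.exp (-∑' n, g n)) := by
        rw [← Real.exp_add]
        gcongr
        linarith
    _ = (∑' n : {n : ℕ // n ∉ I}, a n) * Real.exp (-2 * S) * Real.exp (-∑' n, g n) := by
        ring
    _ ≤ (∑' n, g n - ∑' n : I, g n) * Real.exp (-∑' n, g n) := by
        gcongr
        linarith
    _ ≤ Real.exp (-∑' n : I, g n) - Real.exp (-∑' n, g n) := sub_mul_exp_neg_le _ _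
end

section
/- Let T, c, p ∈ (0,∞), δ ∈ (−∞, 1/2 − 1/(2p)), i ∈ {1,2}, and for n ≥ 1 set λ_n = c n^p. Then for every natural number N ≥ 1 it holds that (1/2) ∑_{n=N+1}^∞ λ_n^{2δ−1} ( T + sin(2 λ_n^{1/2} T)/((−1)^i · 2 λ_n^{1/2}) ) ≥ ( 1 + inf_{x ∈ [2c^{1/2}T,∞)} sin(x)/((−1)^i x) ) · T c^{2δ−1} 2^{p(2δ−1)} N^{p(2δ−1)+1} / ( p(1−2δ) − 1 ) > 0. -/
/-- Mean value bound for the primitive `x ^ (1 - s) / (1 - s)` of `x ^ (-s)`. -/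
theorem rpow_one_sub_sub_le {s x : ℝ} (hs : 1 < s) (hx : 0 < x) :
    x ^ (1 - s) - (x + 1) ^ (1 - s) ≤ (s - 1) * x ^ (-s) := by
  have hx1 : 0 < x + 1 := by linarith
  have hB := one_add_mul_self_le_rpow_one_add (s := -(1 / (x + 1))) (p := s)
    (by rw [neg_le_neg_iff, div_le_one hx1]; linarith) hs.le
  have hq : 1 + -(1 / (x + 1)) = x / (x + 1) := by field_simp; ring
  rw [hq] at hB
  have h1 : x ^ (1 - s) = x * x ^ (-s) := by
    rw [sub_eq_add_neg, Real.rpow_add hx, Real.rpow_one]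
  have h2 : (x + 1) ^ (1 - s) = (x + 1) * (x ^ (-s) * (x / (x + 1)) ^ s) := by
    rw [sub_eq_add_neg, Real.rpow_add hx1, Real.rpow_one, Real.div_rpow hx.le hx1.le,
      Real.rpow_neg hx.le, Real.rpow_neg hx1.le]
    have := Real.rpow_pos_of_pos hx s
    field_simp
  have h3 : x + 1 - s ≤ (x + 1) * (x / (x + 1)) ^ s := by
    calc x + 1 - s = (x + 1) * (1 + s * -(1 / (x + 1))) := by field_simp; ring
      _ ≤ _ := by gcongr
  have := mul_le_mul_of_nonneg_left h3 (Real.rpow_pos_of_pos hx (-s)).le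
  rw [h1, h2]
  linarith

/-- Integral-test lower bound for the tail of a convergent `p`-series. -/
theorem rpow_one_sub_div_le_tsum {s a : ℝ} (hs : 1 < s) (ha : 0 < a)
    (hsum : Summable fun k : ℕ => (a + k) ^ (-s)) :
    a ^ (1 - s) / (s - 1) ≤ ∑' k : ℕ, (a + k) ^ (-s) := by
  have hs1 : 0 < s - 1 := by linarith
  rw [div_le_iff₀' hs1, ← tsum_mul_left]
  have hlim : Filter.Tendsto (fun k : ℕ => a ^ (1 - s) - (a + k) ^ (1 - s)) Filter.atTop
      (nhds (a ^ (1 - s) - 0)) := by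
    refine tendsto_const_nhds.sub ?_
    have h := (tendsto_rpow_neg_atTop hs1).comp
      (Filter.tendsto_atTop_add_const_left _ a tendsto_natCast_atTop_atTop)
    simpa [Function.comp_def] using h
  rw [sub_zero] at hlim
  refine le_of_tendsto_of_tendsto' hlim (hsum.mul_left (s - 1)).hasSum.tendsto_sum_nat fun m => ?_
  calc a ^ (1 - s) - (a + m) ^ (1 - s)
      = ∑ k ∈ Finset.range m, ((a + k) ^ (1 - s) - (a + (k + 1 : ℕ)) ^ (1 - s)) := by
        rw [Finset.sum_range_sub' fun k : ℕ => (a + k) ^ (1 - s)]; simp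
    _ ≤ _ := by
        refine Finset.sum_le_sum fun k _ => ?_
        have := rpow_one_sub_sub_le hs (x := a + k) (by positivity)
        push_cast
        rwa [← add_assoc]

/-- On `[a, ∞)` with `a > 0`, the quotient `|sin x| / x` stays away from `1`. -/
theorem exists_abs_sin_le_mul {a : ℝ} (ha : 0 < a) :
    ∃ r < 1, ∀ x, a ≤ x → |Real.sin x| ≤ r * x := by
  have hd : |Real.sin a| < a := by simpa [abs_of_pos ha] using Real.abs_sin_lt_abs ha.ne'
  refine ⟨max (1 / 2) (1 - (a - |Real.sin a|) / 2), by
    rw [max_lt_iff]; constructor <;> linarith, fun x hx => ?_⟩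
  have hx0 : 0 < x := ha.trans_le hx
  rcases le_total x 2 with h | h
  · calc |Real.sin x| ≤ x - (a - |Real.sin a|) := by
          have h1 := Real.abs_sin_sub_sin_le x a
          rw [abs_of_nonneg (sub_nonneg.2 hx)] at h1
          have h2 := abs_sub_abs_le_abs_sub (Real.sin x) (Real.sin a)
          linarith
      _ ≤ (1 - (a - |Real.sin a|) / 2) * x := by nlinarith
      _ ≤ _ := by gcongr; exact le_max_right _ _
  · calc |Real.sin x| ≤ 1 / 2 * x := by linarith [Real.abs_sin_le_one x]
      _ ≤ _ := by gcongr; exact le_max_left _ _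

/-- The equivalence between `ℕ` and the natural numbers that are at least `m`. -/
def natEquivGe (m : ℕ) : ℕ ≃ {n : ℕ // m ≤ n} where
  toFun k := ⟨m + k, Nat.le_add_right m k⟩
  invFun n := n - m
  left_inv k := by simp
  right_inv n := Subtype.ext (Nat.add_sub_of_le n.2)

/-- Display (2.21) in the proof of Corollary 2.10: for `T, c, p ∈ (0,∞)`,
`δ < 1/2 - 1/(2p)`, `i ∈ {1,2}`, `λ_n = c n^p`, and every `N ≥ 1`,
`(1/2) ∑_{n=N+1}^∞ λ_n^{2δ-1} (T + sin(2√λ_n T)/((-1)^i 2√λ_n))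
  ≥ (1 + inf_{x ∈ [2√c T,∞)} sin x/((-1)^i x)) T c^{2δ-1} 2^{p(2δ-1)} N^{p(2δ-1)+1}
      / (p(1-2δ) - 1) > 0`. -/
theorem stmt_13 (T c p δ : ℝ) (hT : 0 < T) (hc : 0 < c) (hp : 0 < p)
    (hδ : δ < 1 / 2 - 1 / (2 * p)) (i : ℕ) (hi : i = 1 ∨ i = 2) (N : ℕ) (hN : 1 ≤ N) :
    (1 / 2) * ∑' n : {n : ℕ // N + 1 ≤ n},
        (c * ((n : ℕ) : ℝ) ^ p) ^ (2 * δ - 1) *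
          (T + Real.sin (2 * Real.sqrt (c * ((n : ℕ) : ℝ) ^ p) * T) /
            ((-1 : ℝ) ^ i * 2 * Real.sqrt (c * ((n : ℕ) : ℝ) ^ p))) ≥
      (1 + ⨅ x : (Set.Ici (2 * Real.sqrt c * T)), Real.sin x / ((-1 : ℝ) ^ i * (x : ℝ))) *
        T * c ^ (2 * δ - 1) * (2 : ℝ) ^ (p * (2 * δ - 1)) * (N : ℝ) ^ (p * (2 * δ - 1) + 1) /
        (p * (1 - 2 * δ) - 1) ∧
    0 < (1 + ⨅ x : (Set.Ici (2 * Real.sqrt c * T)), Real.sin x / ((-1 : ℝ) ^ i * (x : ℝ))) *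
        T * c ^ (2 * δ - 1) * (2 : ℝ) ^ (p * (2 * δ - 1)) * (N : ℝ) ^ (p * (2 * δ - 1) + 1) /
        (p * (1 - 2 * δ) - 1) := by
  set s : ℝ := p * (1 - 2 * δ) with hs_def
  have hs : 1 < s := by
    have h : 1 / p < 1 - 2 * δ := by
      have : 1 / (2 * p) = 1 / p / 2 := by field_simp
      linarith
    rwa [div_lt_iff₀' hp] at h
  have hps : p * (2 * δ - 1) = -s := by rw [hs_def]; ring
  have hs1 : 0 < s - 1 := by linarith
  have hN0 : (0 : ℝ) < N := by exact_mod_cast hN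
  set a : ℝ := 2 * Real.sqrt c * T with ha_def
  have ha : 0 < a := by positivity
  set σ : ℝ := (-1 : ℝ) ^ i with hσ_def
  have hσ : |σ| = 1 := by simp [hσ_def]
  obtain ⟨r, hr, hsin⟩ := exists_abs_sin_le_mul ha
  have hquot : ∀ x, a ≤ x → |Real.sin x / (σ * x)| ≤ r := fun x hx => by
    have hx0 : 0 < x := ha.trans_le hx
    rw [abs_div, abs_mul, hσ, one_mul, abs_of_pos hx0, div_le_iff₀ hx0]
    exact hsin x hx
  set I : ℝ := ⨅ x : (Set.Ici a), Real.sin x / (σ * (x : ℝ))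
  have hI_le : ∀ x, a ≤ x → I ≤ Real.sin x / (σ * x) := fun x hx =>
    ciInf_le (f := fun x : Set.Ici a => Real.sin x / (σ * (x : ℝ)))
      ⟨-r, by rintro _ ⟨y, rfl⟩; exact (abs_le.1 (hquot y y.2)).1⟩ ⟨x, hx⟩
  have hI : 0 < 1 + I := by
    have : -r ≤ I := le_ciInf fun y : Set.Ici a => (abs_le.1 (hquot y y.2)).1
    linarith
  rw [hps]
  refine ⟨?_, by positivity⟩
  have hterm : ∀ n : ℕ, 1 ≤ n →
      ∃ q : ℝ, I ≤ q ∧ q ≤ 1 ∧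
        (c * (n : ℝ) ^ p) ^ (2 * δ - 1) *
          (T + Real.sin (2 * Real.sqrt (c * (n : ℝ) ^ p) * T) /
            (σ * 2 * Real.sqrt (c * (n : ℝ) ^ p))) =
        T * c ^ (2 * δ - 1) * (1 + q) * (n : ℝ) ^ (-s) := fun n hn => by
    have hn1 : (1 : ℝ) ≤ n := by exact_mod_cast hn
    have hnp : 1 ≤ (n : ℝ) ^ p := Real.one_le_rpow hn1 hp.le
    have hle : a ≤ 2 * Real.sqrt (c * (n : ℝ) ^ p) * T := by
      rw [ha_def]; gcongr; nlinarith
    have hsq : 0 < Real.sqrt (c * (n : ℝ) ^ p) := by positivity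
    refine ⟨_, hI_le _ hle, ((abs_le.1 (hquot _ hle)).2.trans hr.le), ?_⟩
    rw [Real.mul_rpow hc.le (by positivity), ← Real.rpow_mul (by positivity), hps]
    have hσ0 : σ ≠ 0 := by rw [← abs_pos, hσ]; exact one_pos
    field_simp
  choose! q hq_ge hq_le hq using hterm
  have hcast : ∀ k : ℕ, ((N + 1 + k : ℕ) : ℝ) ^ (-s) = ((N + 1 : ℝ) + k) ^ (-s) := fun k => by
    push_cast; rfl
  have hsum : Summable fun k : ℕ => ((N + 1 : ℝ) + k) ^ (-s) := by
    have h := (Real.summable_nat_rpow (p := -s)).2 (by linarith)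
    simpa only [Function.comp_def, hcast] using h.comp_injective (add_right_injective (N + 1))
  rw [← (natEquivGe (N + 1)).tsum_eq]
  have hcongr : ∀ k : ℕ, _ = _ := fun k => hq (N + 1 + k) (by omega)
  simp only [natEquivGe, Equiv.coe_fn_mk]
  rw [tsum_congr hcongr]
  simp only [hcast]
  have hC : 0 < T * c ^ (2 * δ - 1) := by positivity
  have hlow : ∀ k : ℕ, T * c ^ (2 * δ - 1) * (1 + I) * ((N + 1 : ℝ) + k) ^ (-s) ≤
      T * c ^ (2 * δ - 1) * (1 + q (N + 1 + k)) * ((N + 1 : ℝ) + k) ^ (-s) := fun k => by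
    have := hq_ge (N + 1 + k) (by omega)
    gcongr
  have hup : ∀ k : ℕ, T * c ^ (2 * δ - 1) * (1 + q (N + 1 + k)) * ((N + 1 : ℝ) + k) ^ (-s) ≤
      T * c ^ (2 * δ - 1) * (1 + 1) * ((N + 1 : ℝ) + k) ^ (-s) := fun k => by
    have := hq_le (N + 1 + k) (by omega)
    gcongr
  have hsummable := Summable.of_nonneg_of_le
    (fun k => (by positivity : (0 : ℝ) ≤ _).trans (hlow k)) hup (hsum.mul_left _)
  have htail : (2 * N : ℝ) ^ (1 - s) / (s - 1) ≤ ∑' k : ℕ, ((N + 1 : ℝ) + k) ^ (-s) := by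
    refine le_trans ?_ (rpow_one_sub_div_le_tsum hs (by positivity) hsum)
    refine div_le_div_of_nonneg_right ?_ hs1.le
    have hN1 : (1 : ℝ) ≤ N := by exact_mod_cast hN
    exact Real.rpow_le_rpow_of_nonpos (by positivity) (by linarith) (by linarith)
  have hpow : (2 * N : ℝ) ^ (1 - s) = 2 * (2 : ℝ) ^ (-s) * (N : ℝ) ^ (-s + 1) := by
    rw [Real.mul_rpow zero_le_two hN0.le, sub_eq_add_neg, Real.rpow_add two_pos, Real.rpow_one,
      add_comm 1 (-s)]
  calc (1 / 2) * ∑' k : ℕ, T * c ^ (2 * δ - 1) * (1 + q (N + 1 + k)) * ((N + 1 : ℝ) + k) ^ (-s)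
      ≥ (1 / 2) * ∑' k : ℕ, T * c ^ (2 * δ - 1) * (1 + I) * ((N + 1 : ℝ) + k) ^ (-s) := by
        exact mul_le_mul_of_nonneg_left
          (Summable.tsum_le_tsum hlow (hsum.mul_left _) hsummable) (by norm_num)
    _ = (1 / 2) * (T * c ^ (2 * δ - 1) * (1 + I) * ∑' k : ℕ, ((N + 1 : ℝ) + k) ^ (-s)) := by
        rw [tsum_mul_left]
    _ ≥ (1 / 2) * (T * c ^ (2 * δ - 1) * (1 + I) * ((2 * N : ℝ) ^ (1 - s) / (s - 1))) := by
        gcongr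
    _ = _ := by
        rw [hpow]
        ring
end
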